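/- Let d ≥ 1 be an integer and let μ : (0,∞) → [0,∞) be completely monotone (infinitely differentiable with (−1)ⁿ μ⁽ⁿ⁾(t) ≥ 0 for all integers n ≥ 0 and t > 0), not identically zero, with ∫₀^∞ min(t,1) μ(t) dt < ∞. Assume that for every K > 0 there exists c = c(K) > 1 such that μ(r) ≤ c μ(2r) for all r ∈ (0, K). Define j(r) := ∫₀^∞ (4πt)^{-d/2} e^{-r²/(4t)} μ(t) dt for r > 0. Then there exists a constant C > 1 such that j(r) ≤ C j(r+1) for all r > 1. -/

import Mathlib

open MeasureTheory Real Set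

/-- A form of complete monotonicity: `F n` plays the role of `(-1)ⁿ` times the `n`-th derivative
of `F 0`. The quadratic form below is the one obtained by expanding the binomial representation of
order `n` of the sequence `F 0 (t + k * h)`. -/
lemma completelyMonotone_quadratic_nonneg {h : ℝ} (hh : 0 < h) (n : ℕ) :
    ∀ (F : ℕ → ℝ → ℝ), (∀ m t, 0 < t → 0 ≤ F m t) →
      (∀ m t, 0 < t → HasDerivAt (F m) (-F (m + 1) t) t) → ∀ t, 0 < t → ∀ x : ℝ,
      0 ≤ F 0 t * x ^ 2 - 2 * n * x * F 0 (t + h) + n * (n - 1) * F 0 (t + h + h)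
        + n * F 0 (t + h) := by
  induction n with
  | zero =>
    intro F hF _ t ht x
    have := mul_nonneg (hF 0 t ht) (sq_nonneg x)
    simpa using this
  | succ n ih =>
    intro F hF hF' t ht x
    have hanti : ∀ m, AntitoneOn (F m) (Ioi 0) := fun m ↦ by
      refine antitoneOn_of_deriv_nonpos (convex_Ioi 0)
        (fun s hs ↦ (hF' m s hs).continuousAt.continuousWithinAt) ?_ ?_
      · intro s hs
        rw [interior_Ioi] at hs
        exact (hF' m s hs).differentiableAt.differentiableWithinAt
      · intro s hs
        rw [interior_Ioi] at hs
        rw [(hF' m s hs).deriv]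
        exact neg_nonpos.2 (hF _ _ hs)
    have h1 := ih (fun m s ↦ F m s - F m (s + h))
      (fun m s hs ↦ sub_nonneg.2 (hanti m hs (by simp only [mem_Ioi]; linarith) (by linarith)))
      (fun m s hs ↦ by
        exact ((hF' m s hs).sub ((hF' m (s + h) (by linarith)).comp_add_const s h)).congr_deriv
          (by ring)) t ht x
    have h2 := ih F hF hF' (t + h) (by linarith) (x - 1)
    push_cast
    nlinarith [h1, h2]

lemma completelyMonotone_sq_le {h : ℝ} (hh : 0 < h) (F : ℕ → ℝ → ℝ)
    (hF : ∀ m t, 0 < t → 0 ≤ F m t)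
    (hF' : ∀ m t, 0 < t → HasDerivAt (F m) (-F (m + 1) t) t) {t : ℝ} (ht : 0 < t)
    (hpos : 0 < F 0 t) :
    F 0 (t + h) ^ 2 ≤ F 0 t * F 0 (t + h + h) := by
  set a := F 0 t
  set b := F 0 (t + h)
  set c := F 0 (t + h + h)
  by_contra! hlt
  obtain ⟨n, hn⟩ := exists_nat_gt (max 0 (a * (b - c) / (b ^ 2 - a * c)))
  have hn0 : (0 : ℝ) < n := (le_max_left _ _).trans_lt hn
  have hn1 := (le_max_right _ _).trans_lt hn
  rw [div_lt_iff₀ (by linarith)] at hn1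
  have hq := completelyMonotone_quadratic_nonneg hh n F hF hF' t ht (n * b / a)
  have heq : a * (n * b / a) ^ 2 - 2 * n * (n * b / a) * b + n * (n - 1) * c + n * b
      = (n / a) * (a * (b - c) - n * (b ^ 2 - a * c)) := by
    field_simp
    ring
  have : (n / a) * (a * (b - c) - n * (b ^ 2 - a * c)) < 0 :=
    mul_neg_of_pos_of_neg (by positivity) (by linarith)
  change 0 ≤ a * (n * b / a) ^ 2 - 2 * n * (n * b / a) * b + n * (n - 1) * c + n * b at hq
  linarith

lemma exists_le_mul_shift_of_sq_le {f : ℝ → ℝ} {h : ℝ} (hh : 0 < h)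
    (hpos : ∀ t, 0 < t → 0 < f t) (hanti : AntitoneOn f (Ioi 0))
    (hsq : ∀ t, 0 < t → f (t + h) ^ 2 ≤ f t * f (t + h + h)) :
    ∃ c > 0, ∀ t, 1 ≤ t → f t ≤ c * f (t + h) := by
  have h1 := hpos 1 one_pos
  have h2 := hpos (1 + h + h) (by linarith)
  refine ⟨f 1 / f (1 + h + h), by positivity, ?_⟩
  have key : ∀ n : ℕ, ∀ t, 1 ≤ t → t ≤ 1 + (n + 1) * h →
      f t ≤ f 1 / f (1 + h + h) * f (t + h) := by
    intro n
    induction n with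
    | zero =>
      intro t ht ht'
      simp only [Nat.cast_zero] at ht'
      have e1 : f t ≤ f 1 := hanti (by simp) (by simp only [mem_Ioi]; linarith) ht
      have e2 : f (1 + h + h) ≤ f (t + h) :=
        hanti (by simp only [mem_Ioi]; linarith) (by simp only [mem_Ioi]; linarith) (by linarith)
      rw [div_mul_eq_mul_div, le_div_iff₀ h2]
      exact mul_le_mul e1 e2 h2.le h1.le
    | succ n ih =>
      intro t ht ht'
      rcases le_or_gt t (1 + (n + 1) * h) with hle | hgt
      · exact ih t ht hle
      · push_cast at ht'
        have hnn : (0 : ℝ) ≤ n := n.cast_nonneg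
        have hs1 : 1 ≤ t - h := by nlinarith
        have e := ih (t - h) hs1 (by linarith)
        have q := hsq (t - h) (by linarith)
        rw [sub_add_cancel] at e q
        have pt := hpos t (by linarith)
        have pth := hpos (t + h) (by linarith)
        refine le_of_mul_le_mul_right ?_ pt
        nlinarith [mul_le_mul_of_nonneg_right e pth.le]
  intro t ht
  obtain ⟨n, hn⟩ := exists_nat_gt ((t - 1) / h)
  rw [div_lt_iff₀ hh] at hn
  exact key n t ht (by nlinarith)

lemma pos_of_antitoneOn_of_doubling {f : ℝ → ℝ} (hnn : ∀ t, 0 < t → 0 ≤ f t)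
    (hanti : AntitoneOn f (Ioi 0)) (hne : ∃ t > (0 : ℝ), f t ≠ 0)
    (hdbl : ∀ K > (0 : ℝ), ∃ c > (1 : ℝ), ∀ r ∈ Ioo (0 : ℝ) K, f r ≤ c * f (2 * r)) :
    ∀ t, 0 < t → 0 < f t := by
  obtain ⟨s, hs, hfs⟩ := hne
  have key : ∀ n : ℕ, 0 < f (2 ^ n * s) := by
    intro n
    induction n with
    | zero => simpa using lt_of_le_of_ne (hnn s hs) hfs.symm
    | succ n ih =>
      have hp : 0 < 2 ^ n * s := by positivity
      obtain ⟨c, hc, H⟩ := hdbl (2 ^ n * s + 1) (by linarith)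
      have := H (2 ^ n * s) ⟨hp, by linarith⟩
      rw [pow_succ, mul_right_comm, mul_comm _ (2 : ℝ)]
      exact pos_of_mul_pos_right (ih.trans_le this) (by linarith)
  intro t ht
  obtain ⟨n, hn⟩ := pow_unbounded_of_one_lt (t / s) one_lt_two
  rw [div_lt_iff₀ hs] at hn
  exact (key n).trans_le (hanti ht (ht.trans hn) hn.le)

/-- The heat kernel factor is dominated by `min t 1`. -/
lemma exists_heat_factor_le (d : ℕ) {r : ℝ} (hr : 0 < r) :
    ∃ M : ℝ, ∀ t, 0 < t →
      (4 * π * t) ^ (-(d : ℝ) / 2) * Real.exp (-(r ^ 2) / (4 * t)) ≤ M * min t 1 := by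
  have hq : -(d : ℝ) / 2 ≤ 0 := by
    have : (0 : ℝ) ≤ d := d.cast_nonneg
    linarith
  set B : ℝ := (d + 1).factorial * (4 / r ^ 2) ^ (d + 1) with hB
  have hB0 : 0 ≤ B := by positivity
  refine ⟨1 + B, fun t ht ↦ ?_⟩
  have h4 : t ≤ 4 * π * t := by nlinarith [Real.pi_gt_three]
  rcases le_total t 1 with h | h
  · rw [min_eq_left h]
    have e1 : (4 * π * t) ^ (-(d : ℝ) / 2) ≤ (t ^ d)⁻¹ := by
      calc (4 * π * t) ^ (-(d : ℝ) / 2) ≤ t ^ (-(d : ℝ) / 2) :=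
            Real.rpow_le_rpow_of_nonpos ht h4 hq
        _ ≤ t ^ (-(d : ℝ)) := Real.rpow_le_rpow_of_exponent_ge ht h (by linarith)
        _ = (t ^ d)⁻¹ := by rw [Real.rpow_neg ht.le, Real.rpow_natCast]
    have e2 : Real.exp (-(r ^ 2) / (4 * t)) ≤ B * t ^ (d + 1) := by
      have hx : 0 < r ^ 2 / (4 * t) := by positivity
      have := Real.pow_div_factorial_le_exp _ hx.le (d + 1)
      rw [neg_div, Real.exp_neg]
      refine (inv_anti₀ (by positivity) this).trans (le_of_eq ?_)
      rw [hB, mul_assoc, ← mul_pow, show r ^ 2 / (4 * t) = (4 / r ^ 2 * t)⁻¹ by field_simp,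
        inv_pow, inv_div, div_inv_eq_mul]
    calc _ ≤ (t ^ d)⁻¹ * (B * t ^ (d + 1)) :=
          mul_le_mul e1 e2 (Real.exp_pos _).le (by positivity)
      _ = B * t := by
          rw [pow_succ]
          field_simp
      _ ≤ (1 + B) * t := by nlinarith
  · rw [min_eq_right h]
    have e1 : (4 * π * t) ^ (-(d : ℝ) / 2) ≤ 1 :=
      Real.rpow_le_one_of_one_le_of_nonpos (h.trans h4) hq
    have e2 : Real.exp (-(r ^ 2) / (4 * t)) ≤ 1 := by
      rw [Real.exp_le_one_iff, neg_div]
      exact neg_nonpos.2 (by positivity)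
    have := mul_le_mul e1 e2 (Real.exp_pos _).le zero_le_one
    linarith

lemma integrableOn_heat_factor_mul (d : ℕ) {f : ℝ → ℝ} (hnn : ∀ t, 0 < t → 0 ≤ f t)
    (hf : ContinuousOn f (Ioi 0)) (hint : IntegrableOn (fun t => min t 1 * f t) (Ioi 0))
    {r : ℝ} (hr : 0 < r) :
    IntegrableOn
      (fun t ↦ (4 * π * t) ^ (-(d : ℝ) / 2) * Real.exp (-(r ^ 2) / (4 * t)) * f t) (Ioi 0) := by
  obtain ⟨M, hM⟩ := exists_heat_factor_le d hr
  refine Integrable.mono' (hint.const_mul M) ?_ ?_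
  · refine ContinuousOn.aestronglyMeasurable ?_ measurableSet_Ioi
    refine ContinuousOn.mul (ContinuousOn.mul ?_ ?_) hf
    · refine ContinuousOn.rpow_const (by fun_prop) fun t ht ↦ Or.inl ?_
      have : (0 : ℝ) < t := ht
      positivity
    · refine Real.continuous_exp.comp_continuousOn (ContinuousOn.div (by fun_prop) (by fun_prop) ?_)
      intro t ht
      have : (0 : ℝ) < t := ht
      positivity
  · refine (ae_restrict_iff' measurableSet_Ioi).2 (Filter.Eventually.of_forall fun t ht ↦ ?_)
    have ht' : (0 : ℝ) < t := ht
    rw [Real.norm_of_nonneg (mul_nonneg (by positivity) (hnn t ht)), ← mul_assoc]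
    exact mul_le_mul_of_nonneg_right (hM t ht) (hnn t ht)

lemma four_rpow_mul_le (q : ℝ) (hq : q ≤ 0) {s u : ℝ} (hs : 0 < s) (hu : 0 < u)
    (hus : u ≤ 4 * s) : s ^ q ≤ 4 ^ (-q) * u ^ q := by
  have := Real.rpow_le_rpow_of_nonpos hu hus hq
  rw [Real.mul_rpow (by norm_num) hs.le] at this
  rw [Real.rpow_neg (by norm_num), inv_mul_eq_div, le_div_iff₀ (by positivity)]
  linarith

lemma integral_Ioi_le_of_le_dilation_add_shift {f g : ℝ → ℝ} {A B E : ℝ} (hB : 0 ≤ B)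
    (hf : IntegrableOn f (Ioi 0)) (hg : IntegrableOn g (Ioi 0)) (hg0 : ∀ t, 0 < t → 0 ≤ g t)
    (hfg : ∀ t, 0 < t → f t ≤ A * g (4 * t) + B * g (t + 3) + E * g t) :
    ∫ t in Ioi 0, f t ≤ (A / 4 + B + E) * ∫ t in Ioi 0, g t := by
  have i1 : IntegrableOn (fun t ↦ g (4 * t)) (Ioi 0) := by
    rw [integrableOn_Ioi_comp_mul_left_iff g 0 (by norm_num : (0 : ℝ) < 4)]
    simpa using hg
  have hmp := measurePreserving_add_right (volume : Measure ℝ) (3 : ℝ)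
  have hemb : MeasurableEmbedding (fun t : ℝ ↦ t + 3) := measurableEmbedding_addRight 3
  have hpre : (fun t : ℝ ↦ t + 3) ⁻¹' Ioi 3 = Ioi 0 := by
    ext t; simp
  have hg3 : IntegrableOn g (Ioi 3) := hg.mono_set (Ioi_subset_Ioi (by norm_num))
  have i2 : IntegrableOn (fun t ↦ g (t + 3)) (Ioi 0) := by
    have := (hmp.integrableOn_comp_preimage hemb (f := g) (s := Ioi 3)).2 hg3
    rwa [hpre] at this
  have v1 : ∫ t in Ioi 0, g (4 * t) = 4⁻¹ * ∫ t in Ioi 0, g t := by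
    have := integral_comp_mul_left_Ioi g 0 (by norm_num : (0 : ℝ) < 4)
    simpa using this
  have v2 : ∫ t in Ioi 0, g (t + 3) ≤ ∫ t in Ioi 0, g t := by
    have := hmp.setIntegral_preimage_emb hemb g (Ioi 3)
    rw [hpre] at this
    rw [this]
    refine setIntegral_mono_set hg ?_ (Ioi_subset_Ioi (by norm_num)).eventuallyLE
    exact (ae_restrict_iff' measurableSet_Ioi).2 (Filter.Eventually.of_forall hg0)
  calc ∫ t in Ioi 0, f t ≤ ∫ t in Ioi 0, (A * g (4 * t) + B * g (t + 3) + E * g t) :=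
        setIntegral_mono_on hf (((i1.const_mul A).add (i2.const_mul B)).add (hg.const_mul E))
          measurableSet_Ioi hfg
    _ = A * (∫ t in Ioi 0, g (4 * t)) + B * (∫ t in Ioi 0, g (t + 3))
          + E * ∫ t in Ioi 0, g t := by
        rw [integral_add (f := fun t ↦ A * g (4 * t) + B * g (t + 3))
          ((i1.const_mul A).add (i2.const_mul B)) (hg.const_mul E),
          integral_add (i1.const_mul A) (i2.const_mul B), integral_const_mul, integral_const_mul,
          integral_const_mul]
    _ ≤ _ := by
        rw [v1]
        nlinarith [mul_le_mul_of_nonneg_left v2 hB]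

/-- If `μ` is completely monotone (not identically zero) on `(0,∞)` with
`∫₀^∞ min(t,1) μ(t) dt < ∞` and satisfies the doubling condition `μ(r) ≤ c(K) μ(2r)` on
every interval `(0,K)`, then the kernel `j(r) = ∫₀^∞ (4πt)^{-d/2} e^{-r²/(4t)} μ(t) dt`
satisfies `j(r) ≤ C j(r+1)` for all `r > 1`, for some constant `C > 1`. -/
theorem levy_kernel_comparison_at_infinity
    (d : ℕ) (hd : 1 ≤ d) (μ : ℝ → ℝ)
    (hsmooth : ContDiffOn ℝ (⊤ : ℕ∞) μ (Ioi 0))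
    (hsign : ∀ (n : ℕ) (t : ℝ), 0 < t →
      0 ≤ (-1 : ℝ) ^ n * iteratedDerivWithin n μ (Ioi 0) t)
    (hne : ∃ t > (0 : ℝ), μ t ≠ 0)
    (hint : IntegrableOn (fun t => min t 1 * μ t) (Ioi 0))
    (hdbl : ∀ K > (0 : ℝ), ∃ c > (1 : ℝ), ∀ r ∈ Ioo (0 : ℝ) K, μ r ≤ c * μ (2 * r))
    (j : ℝ → ℝ)
    (hj : ∀ r : ℝ, j r =
      ∫ t in Ioi (0 : ℝ), (4 * π * t) ^ (-(d : ℝ) / 2) * Real.exp (-(r ^ 2) / (4 * t)) * μ t) :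
    ∃ C > (1 : ℝ), ∀ r > (1 : ℝ), j r ≤ C * j (r + 1) := by
  have hF : ∀ n t, 0 < t → HasDerivAt (fun s ↦ (-1 : ℝ) ^ n * iteratedDerivWithin n μ (Ioi 0) s)
      (-((-1 : ℝ) ^ (n + 1) * iteratedDerivWithin (n + 1) μ (Ioi 0) t)) t := by
    intro n t ht
    have hd : DifferentiableOn ℝ (iteratedDerivWithin n μ (Ioi 0)) (Ioi 0) :=
      hsmooth.differentiableOn_iteratedDerivWithin (by exact_mod_cast WithTop.coe_lt_top n)
        (uniqueDiffOn_Ioi 0)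
    have := (hd t ht).hasDerivWithinAt.hasDerivAt (Ioi_mem_nhds ht)
    rw [← iteratedDerivWithin_succ] at this
    exact (this.const_mul ((-1 : ℝ) ^ n)).congr_deriv (by ring)
  have hnn : ∀ t, 0 < t → 0 ≤ μ t := fun t ht ↦ by simpa using hsign 0 t ht
  have hcont : ContinuousOn μ (Ioi 0) := hsmooth.continuousOn
  have hanti : AntitoneOn μ (Ioi 0) := by
    refine antitoneOn_of_deriv_nonpos (convex_Ioi 0) hcont ?_ ?_
    · rw [interior_Ioi]
      exact hsmooth.differentiableOn (by simp)
    · intro s hs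
      rw [interior_Ioi] at hs
      have h0 := hF 0 s hs
      simp only [pow_zero, one_mul, iteratedDerivWithin_zero] at h0
      rw [h0.deriv]
      exact neg_nonpos.2 (hsign _ _ hs)
  have hpos := pos_of_antitoneOn_of_doubling hnn hanti hne hdbl
  obtain ⟨b, hb, hshift⟩ := exists_le_mul_shift_of_sq_le (h := 3) (by norm_num) hpos hanti
    fun t ht ↦ by
      have := completelyMonotone_sq_le (h := 3) (by norm_num)
        (fun n s ↦ (-1 : ℝ) ^ n * iteratedDerivWithin n μ (Ioi 0) s) hsign hF ht
        (by simpa using hpos t ht)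
      simpa using this
  obtain ⟨c, hc, hc'⟩ := hdbl 3 (by norm_num)
  have hdil : ∀ t, 0 < t → t ≤ 1 → μ t ≤ c ^ 2 * μ (4 * t) := by
    intro t ht ht1
    have e1 := hc' t ⟨ht, by linarith⟩
    have e2 := hc' (2 * t) ⟨by linarith, by linarith⟩
    rw [← mul_assoc, show (2 * 2 : ℝ) = 4 by norm_num] at e2
    nlinarith
  set q : ℝ := -(d : ℝ) / 2 with hq_def
  have hq : q ≤ 0 := by
    have : (0 : ℝ) ≤ d := d.cast_nonneg
    linarith
  set D : ℝ := 4 ^ (-q)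
  have hD : 0 < D := by positivity
  have he : 1 < Real.exp 1 := Real.one_lt_exp_iff.2 one_pos
  refine ⟨D * c ^ 2 / 4 + D * b + Real.exp 1,
    by nlinarith [mul_pos hD hb, mul_nonneg hD.le (sq_nonneg c)], fun r hr ↦ ?_⟩
  rw [hj, hj]
  set g : ℝ → ℝ := fun t ↦ (4 * π * t) ^ q * Real.exp (-((r + 1) ^ 2) / (4 * t)) * μ t
  have hg0 : ∀ t, 0 < t → 0 ≤ g t := fun t ht ↦ mul_nonneg (by positivity) (hnn t ht)
  refine integral_Ioi_le_of_le_dilation_add_shift (g := g) (by positivity)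
    (integrableOn_heat_factor_mul d hnn hcont hint (by linarith))
    (integrableOn_heat_factor_mul d hnn hcont hint (by linarith)) hg0 fun t ht ↦ ?_
  have g1 : 0 ≤ D * c ^ 2 * g (4 * t) := mul_nonneg (by positivity) (hg0 _ (by linarith))
  have g2 : 0 ≤ D * b * g (t + 3) := mul_nonneg (by positivity) (hg0 _ (by linarith))
  have g3 : 0 ≤ Real.exp 1 * g t := mul_nonneg (by positivity) (hg0 _ ht)
  have compare : ∀ u a : ℝ, 0 < u → u ≤ 4 * t → r ^ 2 * u ≥ (r + 1) ^ 2 * t → μ t ≤ a * μ u →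
      (4 * π * t) ^ q * Real.exp (-(r ^ 2) / (4 * t)) * μ t ≤ D * a * g u := by
    intro u a hu hut hru hμ
    have e1 : (4 * π * t) ^ q ≤ D * (4 * π * u) ^ q :=
      four_rpow_mul_le q hq (by positivity) (by positivity) (by nlinarith [Real.pi_pos])
    have e2 : Real.exp (-(r ^ 2) / (4 * t)) ≤ Real.exp (-((r + 1) ^ 2) / (4 * u)) := by
      rw [Real.exp_le_exp, neg_div, neg_div, neg_le_neg_iff, div_le_div_iff₀ (by positivity)
        (by positivity)]
      linarith
    calc _ ≤ D * (4 * π * u) ^ q * Real.exp (-((r + 1) ^ 2) / (4 * u)) * (a * μ u) :=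
          mul_le_mul (mul_le_mul e1 e2 (Real.exp_pos _).le (by positivity)) hμ (hnn t ht)
            (by positivity)
      _ = D * a * g u := by simp only [g]; ring
  rcases le_or_gt t 1 with h1 | h1
  · have := compare (4 * t) (c ^ 2) (by linarith) le_rfl
      (by nlinarith [mul_pos ht (by nlinarith : 0 < 3 * r ^ 2 - 2 * r - 1)]) (hdil t ht h1)
    linarith
  rcases le_or_gt t r with h2 | h2
  · have := compare (t + 3) b (by linarith) (by linarith)
      (by nlinarith [mul_le_mul_of_nonneg_left h2 (by linarith : 0 ≤ 2 * r + 1)])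
      (hshift t h1.le)
    linarith
  · have e2 : Real.exp (-(r ^ 2) / (4 * t)) ≤
        Real.exp 1 * Real.exp (-((r + 1) ^ 2) / (4 * t)) := by
      rw [← Real.exp_add, Real.exp_le_exp, ← sub_le_iff_le_add, ← sub_nonneg]
      have : 1 - (-(r ^ 2) / (4 * t) - -((r + 1) ^ 2) / (4 * t))
          = (4 * t - (2 * r + 1)) / (4 * t) := by
        field_simp
        ring
      rw [this]
      exact div_nonneg (by linarith) (by positivity)
    have : (4 * π * t) ^ q * Real.exp (-(r ^ 2) / (4 * t)) * μ t ≤ Real.exp 1 * g t := by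
      calc _ ≤ (4 * π * t) ^ q * (Real.exp 1 * Real.exp (-((r + 1) ^ 2) / (4 * t))) * μ t :=
            mul_le_mul_of_nonneg_right (mul_le_mul_of_nonneg_left e2 (by positivity)) (hnn t ht)
        _ = _ := by simp only [g]; ring
    linarith
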